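/- The 3-color difference Ramsey number D(3, 3, 4) equals 30: for every coloring c of {1, …, 29} by three colors, the difference coloring of the complete graph on {1, …, 30} contains a triangle in color 1, a triangle in color 2, or a K_4 in color 3, and there exists a 3-coloring of {1, …, 28} such that the difference coloring of the complete graph on {1, …, 29} contains none of these. -/

import Mathlib

/-- A monochromatic `m`-clique in color `t` of the difference coloring of `K_n`
determined by the coloring `c` of the differences: a set of `m` vertices in `{1, …, n}`
all of whose pairwise differences receive color `t`. -/
def HasMonoClique (c : ℕ → Fin 3) (t : Fin 3) (n m : ℕ) : Prop :=
  ∃ V : Finset ℕ, (∀ v ∈ V, 1 ≤ v ∧ v ≤ n) ∧ V.card = m ∧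
    ∀ i ∈ V, ∀ j ∈ V, i < j → c (j - i) = t

/-- The 3-color difference Ramsey number `D(3, 3, 4)`: the least `N` such that every
3-coloring of the differences `{1, …, N-1}` yields, in the difference coloring of `K_N`,
a triangle in color `0`, a triangle in color `1`, or a `K_4` in color `2`. -/
noncomputable def diffRamsey334 : ℕ :=
  sInf {N | ∀ c : ℕ → Fin 3,
    HasMonoClique c 0 N 3 ∨ HasMonoClique c 1 N 3 ∨ HasMonoClique c 2 N 4}

/-- Bit test by kernel-accelerated operations. -/
def bitAt (x i : ℕ) : Bool := Nat.beq (Nat.land (Nat.shiftRight x i) 1) 1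

theorem bitAt_eq (x i : ℕ) : bitAt x i = x.testBit i := by
  have h : bitAt x i = Nat.beq ((x >>> i) &&& 1) 1 := rfl
  rw [h, Nat.and_one_is_mod, Nat.shiftRight_eq_div_pow, Nat.testBit_eq_decide_div_mod_eq,
    Bool.eq_iff_iff, decide_eq_true_eq, Nat.beq_eq]

/-- New differences that may no longer get color 2 once `d` gets color 2. -/
def forb2 (C d : ℕ) (l : List ℕ) : ℕ :=
  List.rec (motive := fun _ => ℕ) 0
    (fun b _ r => cond (bitAt C (Nat.sub d b))
      (Nat.lor r (Nat.shiftLeft (Nat.land C (Nat.shiftRight C b)) d)) r) l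

/-- Exhaustive search: `true` means that every branch is refuted. The masks `A B C` hold the
differences of color 0, 1, 2 so far, and `FA FB FC` those that may not get that color. -/
def srch (fuel : ℕ) : ℕ → ℕ → ℕ → ℕ → ℕ → ℕ → ℕ → List ℕ → Bool :=
  Nat.rec (motive := fun _ => ℕ → ℕ → ℕ → ℕ → ℕ → ℕ → ℕ → List ℕ → Bool)
    (fun _ _ _ _ _ _ _ _ => false)
    (fun _ ih d A B C FA FB FC l =>
      cond (Nat.beq (Nat.land (Nat.land FA FB) (Nat.land FC 1073741823)) 0)
        (cond (cond (bitAt FA d) true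
            (ih (Nat.add d 1) (Nat.lor A (Nat.shiftLeft 1 d)) B C
              (Nat.lor FA (Nat.shiftLeft (Nat.lor A (Nat.shiftLeft 1 d)) d)) FB FC l))
          (cond (cond (bitAt FB d) true
              (ih (Nat.add d 1) A (Nat.lor B (Nat.shiftLeft 1 d)) C
                FA (Nat.lor FB (Nat.shiftLeft (Nat.lor B (Nat.shiftLeft 1 d)) d)) FC l))
            (cond (bitAt FC d) true
              (ih (Nat.add d 1) A B (Nat.lor C (Nat.shiftLeft 1 d)) FA FB
                (Nat.lor FC (forb2 (Nat.lor C (Nat.shiftLeft 1 d)) d l)) (d :: l)))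
            false)
          false)
        true) fuel

/-- `M` contains only positive differences of color `t`. -/
def ColMask (c : ℕ → Fin 3) (t : Fin 3) (M : ℕ) : Prop :=
  ∀ i, M.testBit i = true → 1 ≤ i ∧ c i = t

/-- The entries of `F` up to 29 do not have color `t`. -/
def ForbMask (c : ℕ → Fin 3) (t : Fin 3) (F : ℕ) : Prop :=
  ∀ i, F.testBit i = true → i ≤ 29 → c i ≠ t

theorem ColMask.insert {c : ℕ → Fin 3} {t : Fin 3} {M d : ℕ} (h : ColMask c t M)
    (hd : 1 ≤ d) (hc : c d = t) : ColMask c t (Nat.lor M (Nat.shiftLeft 1 d)) := by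
  intro i hi
  have hi' : (M ||| (1 <<< d)).testBit i = true := hi
  rw [Nat.testBit_or, Bool.or_eq_true] at hi'
  rcases hi' with hi' | hi'
  · exact h i hi'
  · rw [Nat.one_shiftLeft, Nat.testBit_two_pow] at hi'
    have : d = i := by simpa using hi'
    subst this
    exact ⟨hd, hc⟩

theorem ForbMask.union {c : ℕ → Fin 3} {t : Fin 3} {F G : ℕ} (hF : ForbMask c t F)
    (hG : ForbMask c t G) : ForbMask c t (Nat.lor F G) := by
  intro i hi h29
  have hi' : (F ||| G).testBit i = true := hi
  rw [Nat.testBit_or, Bool.or_eq_true] at hi'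
  exact hi'.elim (fun h => hF i h h29) (fun h => hG i h h29)

theorem ForbMask.shift {c : ℕ → Fin 3} {t : Fin 3} {M d : ℕ}
    (H : ∀ x y, 1 ≤ x → 1 ≤ y → x + y ≤ 29 → c x = t → c y = t → c (x + y) ≠ t)
    (hM : ColMask c t M) (hd : 1 ≤ d) (hc : c d = t) :
    ForbMask c t (Nat.shiftLeft M d) := by
  intro i hi h29
  have hi' : (M <<< d).testBit i = true := hi
  rw [Nat.testBit_shiftLeft, Bool.and_eq_true, decide_eq_true_eq] at hi'
  obtain ⟨h1, h2⟩ := hi'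
  obtain ⟨h3, h4⟩ := hM _ h2
  have := H d (i - d) hd h3 (by omega) hc h4
  rwa [show d + (i - d) = i by omega] at this

theorem ForbMask.forb2 {c : ℕ → Fin 3} {t : Fin 3} {C d : ℕ}
    (H : ∀ x y z, 1 ≤ x → 1 ≤ y → 1 ≤ z → x + y + z ≤ 29 → c x = t → c y = t → c z = t →
      c (x + y) = t → c (y + z) = t → c (x + y + z) ≠ t)
    (hC : ColMask c t C) (hc : c d = t) (l : List ℕ)
    (hl : ∀ b ∈ l, 1 ≤ b ∧ c b = t) :
    ForbMask c t (forb2 C d l) := by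
  induction l with
  | nil =>
    intro i hi
    have : (0 : ℕ).testBit i = true := hi
    simp at this
  | cons b l ih =>
    have ih := ih (fun x hx => hl x (List.mem_cons_of_mem _ hx))
    have hb := hl b List.mem_cons_self
    have e : _root_.forb2 C d (b :: l) = cond (bitAt C (Nat.sub d b))
      (Nat.lor (_root_.forb2 C d l) (Nat.shiftLeft (Nat.land C (Nat.shiftRight C b)) d))
      (_root_.forb2 C d l) := rfl
    rw [e]
    cases hbit : bitAt C (Nat.sub d b) with
    | false => exact ih
    | true =>
      refine ih.union ?_
      rw [bitAt_eq] at hbit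
      obtain ⟨h1, h2⟩ := hC _ hbit
      change 1 ≤ d - b at h1
      change c (d - b) = t at h2
      intro i hi h29
      have hi' : ((C &&& (C >>> b)) <<< d).testBit i = true := hi
      rw [Nat.testBit_shiftLeft, Bool.and_eq_true, decide_eq_true_eq, Nat.testBit_and,
        Bool.and_eq_true, Nat.testBit_shiftRight] at hi'
      obtain ⟨h3, h4, h5⟩ := hi'
      obtain ⟨h6, h7⟩ := hC _ h4
      obtain ⟨h8, h9⟩ := hC _ h5
      have := H (d - b) b (i - d) h1 hb.1 h6 (by omega) h2 hb.2 h7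
        (by rwa [show d - b + b = d by omega]) h9
      rwa [show d - b + b + (i - d) = i by omega] at this

theorem srch_sound {c : ℕ → Fin 3}
    (H0 : ∀ x y, 1 ≤ x → 1 ≤ y → x + y ≤ 29 → c x = 0 → c y = 0 → c (x + y) ≠ 0)
    (H1 : ∀ x y, 1 ≤ x → 1 ≤ y → x + y ≤ 29 → c x = 1 → c y = 1 → c (x + y) ≠ 1)
    (H2 : ∀ x y z, 1 ≤ x → 1 ≤ y → 1 ≤ z → x + y + z ≤ 29 → c x = 2 → c y = 2 → c z = 2 →
      c (x + y) = 2 → c (y + z) = 2 → c (x + y + z) ≠ 2)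
    (fuel : ℕ) : ∀ (d A B C FA FB FC : ℕ) (l : List ℕ), 1 ≤ d → d + fuel ≤ 30 →
      ColMask c 0 A → ColMask c 1 B → ColMask c 2 C →
      ForbMask c 0 FA → ForbMask c 1 FB → ForbMask c 2 FC →
      (∀ b ∈ l, 1 ≤ b ∧ c b = 2) →
      srch fuel d A B C FA FB FC l ≠ true := by
  induction fuel with
  | zero =>
    intro d A B C FA FB FC l _ _ _ _ _ _ _ _ _ h
    exact Bool.false_ne_true h
  | succ k ih =>
    intro d A B C FA FB FC l hd hk hA hB hC hFA hFB hFC hl h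
    change cond (Nat.beq (Nat.land (Nat.land FA FB) (Nat.land FC 1073741823)) 0)
        (cond (cond (bitAt FA d) true
            (srch k (Nat.add d 1) (Nat.lor A (Nat.shiftLeft 1 d)) B C
              (Nat.lor FA (Nat.shiftLeft (Nat.lor A (Nat.shiftLeft 1 d)) d)) FB FC l))
          (cond (cond (bitAt FB d) true
              (srch k (Nat.add d 1) A (Nat.lor B (Nat.shiftLeft 1 d)) C
                FA (Nat.lor FB (Nat.shiftLeft (Nat.lor B (Nat.shiftLeft 1 d)) d)) FC l))
            (cond (bitAt FC d) true
              (srch k (Nat.add d 1) A B (Nat.lor C (Nat.shiftLeft 1 d)) FA FB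
                (Nat.lor FC (forb2 (Nat.lor C (Nat.shiftLeft 1 d)) d l)) (d :: l)))
            false)
          false)
        true = true at h
    cases hz : Nat.beq (Nat.land (Nat.land FA FB) (Nat.land FC 1073741823)) 0 with
    | false =>
      have hne : (FA &&& FB) &&& (FC &&& (2 ^ 30 - 1)) ≠ 0 := by
        intro h0
        have h0' : Nat.land (Nat.land FA FB) (Nat.land FC 1073741823) = 0 := h0
        rw [h0'] at hz
        exact absurd hz (by decide)
      obtain ⟨i, hi⟩ := Nat.exists_testBit_of_ne_zero hne
      rw [Nat.testBit_and, Nat.testBit_and, Nat.testBit_and, Nat.testBit_two_pow_sub_one] at hi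
      simp only [Bool.and_eq_true, decide_eq_true_eq] at hi
      obtain ⟨⟨h1, h2⟩, h3, h4⟩ := hi
      have a0 := hFA i h1 (by omega)
      have a1 := hFB i h2 (by omega)
      have a2 := hFC i h3 (by omega)
      generalize c i = x at a0 a1 a2
      fin_cases x
      · exact a0 rfl
      · exact a1 rfl
      · exact a2 rfl
    | true =>
      rw [hz] at h
      have key : ∀ p q r : Bool, cond true (cond p (cond q r false) false) true = true →
          p = true ∧ q = true ∧ r = true := by decide
      obtain ⟨p, q, r⟩ := key _ _ _ h
      have key2 : ∀ p q : Bool, cond p true q = true → p = true ∨ q = true := by decide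
      have hd' : 1 ≤ Nat.add d 1 := Nat.le_add_left 1 d
      have hk' : Nat.add d 1 + k ≤ 30 := by
        change d + 1 + k ≤ 30
        omega
      have h3 : c d = 0 ∨ c d = 1 ∨ c d = 2 := by
        generalize c d = x
        revert x
        decide
      rcases h3 with hc | hc | hc
      · rcases key2 _ _ p with p | p
        · rw [bitAt_eq] at p
          exact hFA d p (by omega) hc
        · have hA' := hA.insert hd hc
          exact ih _ _ _ _ _ _ _ _ hd' hk' hA' hB hC
            (hFA.union (ForbMask.shift H0 hA' hd hc)) hFB hFC hl p
      · rcases key2 _ _ q with q | q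
        · rw [bitAt_eq] at q
          exact hFB d q (by omega) hc
        · have hB' := hB.insert hd hc
          exact ih _ _ _ _ _ _ _ _ hd' hk' hA hB' hC
            hFA (hFB.union (ForbMask.shift H1 hB' hd hc)) hFC hl q
      · rcases key2 _ _ r with r | r
        · rw [bitAt_eq] at r
          exact hFC d r (by omega) hc
        · have hC' := hC.insert hd hc
          refine ih _ _ _ _ _ _ _ _ hd' hk' hA hB hC'
            hFA hFB (hFC.union (ForbMask.forb2 H2 hC' hc l hl)) ?_ r
          intro b hb
          rcases List.mem_cons.1 hb with rfl | hb
          · exact ⟨hd, hc⟩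
          · exact hl b hb

theorem srch_run : srch 29 1 0 0 0 0 0 0 [] = true := by
  decide +kernel

theorem clique3_of {c : ℕ → Fin 3} {t : Fin 3} {x y : ℕ} (hx : 1 ≤ x) (hy : 1 ≤ y)
    (h : x + y ≤ 29) (h1 : c x = t) (h2 : c y = t) (h3 : c (x + y) = t) :
    HasMonoClique c t 30 3 := by
  refine ⟨{1, 1 + x, 1 + x + y}, ?_, ?_, ?_⟩
  · intro v hv
    simp only [Finset.mem_insert, Finset.mem_singleton] at hv
    omega
  · rw [Finset.card_eq_three]
    exact ⟨_, _, _, by omega, by omega, by omega, rfl⟩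
  · intro i hi j hj hij
    simp only [Finset.mem_insert, Finset.mem_singleton] at hi hj
    have : j - i = x ∨ j - i = y ∨ j - i = x + y := by omega
    rcases this with e | e | e <;> rw [e] <;> assumption

theorem clique4_of {c : ℕ → Fin 3} {t : Fin 3} {x y z : ℕ} (hx : 1 ≤ x) (hy : 1 ≤ y)
    (hz : 1 ≤ z) (h : x + y + z ≤ 29) (h1 : c x = t) (h2 : c y = t) (h3 : c z = t)
    (h4 : c (x + y) = t) (h5 : c (y + z) = t) (h6 : c (x + y + z) = t) :
    HasMonoClique c t 30 4 := by
  refine ⟨{1, 1 + x, 1 + x + y, 1 + x + y + z}, ?_, ?_, ?_⟩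
  · intro v hv
    simp only [Finset.mem_insert, Finset.mem_singleton] at hv
    omega
  · rw [Finset.card_insert_of_notMem, Finset.card_eq_three.2
      ⟨_, _, _, by omega, by omega, by omega, rfl⟩]
    simp only [Finset.mem_insert, Finset.mem_singleton]
    omega
  · intro i hi j hj hij
    simp only [Finset.mem_insert, Finset.mem_singleton] at hi hj
    have : j - i = x ∨ j - i = y ∨ j - i = z ∨ j - i = x + y ∨ j - i = y + z ∨
      j - i = x + y + z := by omega
    rcases this with e | e | e | e | e | e <;> rw [e] <;> assumption

theorem upper334 (c : ℕ → Fin 3) :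
    HasMonoClique c 0 30 3 ∨ HasMonoClique c 1 30 3 ∨ HasMonoClique c 2 30 4 := by
  by_contra hcon
  rw [not_or, not_or] at hcon
  obtain ⟨n0, n1, n2⟩ := hcon
  have zc : ∀ t, ColMask c t 0 := by
    intro t i hi
    simp at hi
  have zf : ∀ t, ForbMask c t 0 := by
    intro t i hi
    simp at hi
  refine srch_sound (c := c) ?_ ?_ ?_ 29 1 0 0 0 0 0 0 [] le_rfl (by norm_num) (zc 0) (zc 1)
    (zc 2) (zf 0) (zf 1) (zf 2) (by simp) srch_run
  · intro x y hx hy h h1 h2 h3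
    exact n0 (clique3_of hx hy h h1 h2 h3)
  · intro x y hx hy h h1 h2 h3
    exact n1 (clique3_of hx hy h h1 h2 h3)
  · intro x y z hx hy hz h h1 h2 h3 h4 h5 h6
    exact n2 (clique4_of hx hy hz h h1 h2 h3 h4 h5 h6)

theorem of_clique3 {c : ℕ → Fin 3} {t : Fin 3} (h : HasMonoClique c t 29 3) :
    ∃ x < 29, ∃ y < 29, 1 ≤ x ∧ 1 ≤ y ∧ x + y < 29 ∧ c x = t ∧ c y = t ∧ c (x + y) = t := by
  obtain ⟨V, hV, hcard, hcol⟩ := h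
  let f := V.orderEmbOfFin hcard
  have hm : ∀ i, f i ∈ V := fun i => V.orderEmbOfFin_mem hcard i
  have h01 : f 0 < f 1 := f.strictMono (by decide)
  have h12 : f 1 < f 2 := f.strictMono (by decide)
  have b0 := hV _ (hm 0)
  have b2 := hV _ (hm 2)
  have a := hcol _ (hm 0) _ (hm 1) h01
  have b := hcol _ (hm 1) _ (hm 2) h12
  have d := hcol _ (hm 0) _ (hm 2) (h01.trans h12)
  refine ⟨f 1 - f 0, by omega, f 2 - f 1, by omega, by omega, by omega, by omega, a, b, ?_⟩
  rwa [show f 1 - f 0 + (f 2 - f 1) = f 2 - f 0 by omega]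

theorem of_clique4 {c : ℕ → Fin 3} {t : Fin 3} (h : HasMonoClique c t 29 4) :
    ∃ x < 29, ∃ y < 29, ∃ z < 29, 1 ≤ x ∧ 1 ≤ y ∧ 1 ≤ z ∧ x + y + z < 29 ∧ c x = t ∧ c y = t ∧
      c z = t ∧ c (x + y) = t ∧ c (y + z) = t ∧ c (x + y + z) = t := by
  obtain ⟨V, hV, hcard, hcol⟩ := h
  let f := V.orderEmbOfFin hcard
  have hm : ∀ i, f i ∈ V := fun i => V.orderEmbOfFin_mem hcard i
  have h01 : f 0 < f 1 := f.strictMono (by decide)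
  have h12 : f 1 < f 2 := f.strictMono (by decide)
  have h23 : f 2 < f 3 := f.strictMono (by decide)
  have b0 := hV _ (hm 0)
  have b3 := hV _ (hm 3)
  have a1 := hcol _ (hm 0) _ (hm 1) h01
  have a2 := hcol _ (hm 1) _ (hm 2) h12
  have a3 := hcol _ (hm 2) _ (hm 3) h23
  have a4 := hcol _ (hm 0) _ (hm 2) (h01.trans h12)
  have a5 := hcol _ (hm 1) _ (hm 3) (h12.trans h23)
  have a6 := hcol _ (hm 0) _ (hm 3) (h01.trans (h12.trans h23))
  refine ⟨f 1 - f 0, by omega, f 2 - f 1, by omega, f 3 - f 2, by omega, by omega, by omega,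
    by omega, by omega, a1, a2, a3, ?_, ?_, ?_⟩
  · rwa [show f 1 - f 0 + (f 2 - f 1) = f 2 - f 0 by omega]
  · rwa [show f 2 - f 1 + (f 3 - f 2) = f 3 - f 1 by omega]
  · rwa [show f 1 - f 0 + (f 2 - f 1) + (f 3 - f 2) = f 3 - f 0 by omega]

/-- A good coloring of `{1, …, 28}` (entry 0 is irrelevant). -/
def goodCol (i : ℕ) : Fin 3 :=
  ([0, 2, 0, 2, 1, 0, 2, 2, 0, 0, 1, 1, 2, 1, 2, 2, 1, 2, 1, 1, 0, 0, 2, 2, 0, 1, 2, 0, 2] : List (Fin 3)).getD i 0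

theorem goodCol_spec :
    ¬ HasMonoClique goodCol 0 29 3 ∧ ¬ HasMonoClique goodCol 1 29 3 ∧
      ¬ HasMonoClique goodCol 2 29 4 := by
  refine ⟨fun h => absurd (of_clique3 h) ?_, fun h => absurd (of_clique3 h) ?_,
    fun h => absurd (of_clique4 h) ?_⟩
  · decide +kernel
  · decide +kernel
  · decide +kernel

theorem HasMonoClique.mono {c : ℕ → Fin 3} {t : Fin 3} {n n' m : ℕ} (h : HasMonoClique c t n m)
    (hn : n ≤ n') : HasMonoClique c t n' m := by
  obtain ⟨V, hV, h2⟩ := h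
  exact ⟨V, fun v hv => ⟨(hV v hv).1, (hV v hv).2.trans hn⟩, h2⟩

/-- `D(3, 3, 4) = 30`: every 3-coloring of the differences `{1, …, 29}` yields, in the
difference coloring of `K_30`, a triangle in color `0`, a triangle in color `1`, or a
`K_4` in color `2`; and some 3-coloring of `{1, …, 28}` yields none of these in the
difference coloring of `K_29`. -/
theorem diffRamsey_3_3_4 :
    diffRamsey334 = 30 ∧
    (∀ c : ℕ → Fin 3,
      HasMonoClique c 0 30 3 ∨ HasMonoClique c 1 30 3 ∨ HasMonoClique c 2 30 4) ∧
    (∃ c : ℕ → Fin 3,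
      ¬ HasMonoClique c 0 29 3 ∧ ¬ HasMonoClique c 1 29 3 ∧ ¬ HasMonoClique c 2 29 4) := by
  refine ⟨?_, upper334, goodCol, goodCol_spec⟩
  refine le_antisymm (Nat.sInf_le upper334) ?_
  refine le_csInf ⟨30, upper334⟩ ?_
  intro N hN
  by_contra hlt
  have hle : N ≤ 29 := by omega
  obtain ⟨g0, g1, g2⟩ := goodCol_spec
  rcases hN goodCol with h | h | h
  · exact g0 (h.mono hle)
  · exact g1 (h.mono hle)
  · exact g2 (h.mono hle)
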